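/- arXiv:2105.05836 — 9 statements merged into one kernel-verified Lean document; each statement's English description precedes it below -/
import Mathlib

section
/- Suppose there is a constant c₀ > 0 such that ‖w‖_X ≤ c₀(‖Bw‖_{Y'} + ‖γ₀w‖_{H₀}) for all w ∈ X. If 0 < ε ≤ 1 and u_ε ∈ X satisfies G_ε(u_ε) ≤ G_ε(w) for all w ∈ X, then ‖u_ε‖_X ≤ (2√2·c₀/ε)·√(‖g‖²_{Y'} + ‖f‖²_{H_ω}). -/
/-- Stability bound for the regularized minimizer. -/
theorem stmt_2
    {X Y Hω H₀ : Type*}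
    [NormedAddCommGroup X] [InnerProductSpace ℝ X] [CompleteSpace X]
    [NormedAddCommGroup Y] [InnerProductSpace ℝ Y] [CompleteSpace Y]
    [NormedAddCommGroup Hω] [InnerProductSpace ℝ Hω] [CompleteSpace Hω]
    [NormedAddCommGroup H₀] [InnerProductSpace ℝ H₀] [CompleteSpace H₀]
    (B : X →L[ℝ] (Y →L[ℝ] ℝ)) (Γ : X →L[ℝ] Hω) (γ₀ : X →L[ℝ] H₀)
    (g : Y →L[ℝ] ℝ) (f : Hω)
    (c₀ : ℝ) (hc₀ : 0 < c₀)
    (hstab : ∀ w : X, ‖w‖ ≤ c₀ * (‖B w‖ + ‖γ₀ w‖))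
    (ε : ℝ) (hε : 0 < ε) (hε1 : ε ≤ 1)
    (uε : X)
    (hmin : ∀ w : X,
      ‖B uε - g‖ ^ 2 + ‖Γ uε - f‖ ^ 2 + ε ^ 2 * ‖γ₀ uε‖ ^ 2 ≤
        ‖B w - g‖ ^ 2 + ‖Γ w - f‖ ^ 2 + ε ^ 2 * ‖γ₀ w‖ ^ 2) :
    ‖uε‖ ≤ (2 * Real.sqrt 2 * c₀ / ε) * Real.sqrt (‖g‖ ^ 2 + ‖f‖ ^ 2) := by
  set S := Real.sqrt (‖g‖ ^ 2 + ‖f‖ ^ 2)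
  have hS0 : 0 ≤ S := Real.sqrt_nonneg _
  have hSsq : S ^ 2 = ‖g‖ ^ 2 + ‖f‖ ^ 2 := Real.sq_sqrt (by positivity)
  have hgS : ‖g‖ ≤ S := Real.le_sqrt_of_sq_le (by nlinarith [sq_nonneg ‖f‖])
  have hmin0 : ‖B uε - g‖ ^ 2 + ‖Γ uε - f‖ ^ 2 + ε ^ 2 * ‖γ₀ uε‖ ^ 2 ≤ S ^ 2 := by
    simpa [hSsq] using hmin 0
  have hBu : ‖B uε‖ ≤ ‖B uε - g‖ + ‖g‖ := by
    simpa using norm_add_le (B uε - g) g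
  have h2 : Real.sqrt 2 ^ 2 = 2 := Real.sq_sqrt (by norm_num)
  have h1 : 1 ≤ Real.sqrt 2 := Real.one_le_sqrt.mpr (by norm_num)
  have hsum : ‖B uε - g‖ + ε * ‖γ₀ uε‖ ≤ Real.sqrt 2 * S := by
    refine le_of_abs_le (abs_le_of_sq_le_sq ?_ (by positivity))
    rw [mul_pow, h2]
    nlinarith [sq_nonneg (‖B uε - g‖ - ε * ‖γ₀ uε‖), sq_nonneg ‖Γ uε - f‖]
  have hres : ε * ‖B uε‖ ≤ ‖B uε - g‖ + ‖g‖ :=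
    (mul_le_of_le_one_left (norm_nonneg _) hε1).trans hBu
  have hkey : (‖B uε‖ + ‖γ₀ uε‖) * ε ≤ 2 * Real.sqrt 2 * S := by
    nlinarith [mul_le_mul_of_nonneg_right h1 hS0]
  calc ‖uε‖ ≤ c₀ * (‖B uε‖ + ‖γ₀ uε‖) := hstab uε
    _ ≤ c₀ * (2 * Real.sqrt 2 * S / ε) := by
      gcongr
      exact (le_div_iff₀ hε).mpr hkey
    _ = 2 * Real.sqrt 2 * c₀ / ε * S := by ring
end

section
/- Suppose there is a constant c₀ > 0 such that ‖w‖_X ≤ c₀(‖Bw‖_{Y'} + ‖γ₀w‖_{H₀}) for all w ∈ X. If 0 < ε ≤ 1 and u_ε ∈ X satisfies G_ε(u_ε) ≤ G_ε(w) for all w ∈ X, then for every reference state u ∈ X one has ‖u − u_ε‖_X ≤ (2√2·c₀/ε)·(e_cons(u) + ε‖γ₀u‖_{H₀}). -/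
/-- Basic (crude) error bound in the full norm for the regularized minimizer. -/
theorem stmt_3
    {X Y Hω H₀ : Type*}
    [NormedAddCommGroup X] [InnerProductSpace ℝ X] [CompleteSpace X]
    [NormedAddCommGroup Y] [InnerProductSpace ℝ Y] [CompleteSpace Y]
    [NormedAddCommGroup Hω] [InnerProductSpace ℝ Hω] [CompleteSpace Hω]
    [NormedAddCommGroup H₀] [InnerProductSpace ℝ H₀] [CompleteSpace H₀]
    (B : X →L[ℝ] (Y →L[ℝ] ℝ)) (Γ : X →L[ℝ] Hω) (γ₀ : X →L[ℝ] H₀)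
    (g : Y →L[ℝ] ℝ) (f : Hω)
    (c₀ : ℝ) (hc₀ : 0 < c₀)
    (hstab : ∀ w : X, ‖w‖ ≤ c₀ * (‖B w‖ + ‖γ₀ w‖))
    (ε : ℝ) (hε : 0 < ε) (hε1 : ε ≤ 1)
    (uε : X)
    (hmin : ∀ w : X,
      ‖B uε - g‖ ^ 2 + ‖Γ uε - f‖ ^ 2 + ε ^ 2 * ‖γ₀ uε‖ ^ 2 ≤
        ‖B w - g‖ ^ 2 + ‖Γ w - f‖ ^ 2 + ε ^ 2 * ‖γ₀ w‖ ^ 2) :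
    ∀ u : X,
      ‖u - uε‖ ≤ (2 * Real.sqrt 2 * c₀ / ε) *
        (Real.sqrt (‖B u - g‖ ^ 2 + ‖Γ u - f‖ ^ 2) + ε * ‖γ₀ u‖) := by
  intro u
  have hres : ‖B (u - uε)‖ ≤ ‖B u - g‖ + ‖B uε - g‖ := by
    rw [map_sub, ← sub_sub_sub_cancel_right (B u) (B uε) g]
    exact norm_sub_le _ _
  have htrace : ‖γ₀ (u - uε)‖ ≤ ‖γ₀ u‖ + ‖γ₀ uε‖ := by
    rw [map_sub]
    exact norm_sub_le _ _
  set E := Real.sqrt (‖B u - g‖ ^ 2 + ‖Γ u - f‖ ^ 2) with hE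
  have hE0 : 0 ≤ E := Real.sqrt_nonneg _
  have hEsq : E ^ 2 = ‖B u - g‖ ^ 2 + ‖Γ u - f‖ ^ 2 := Real.sq_sqrt (by positivity)
  have hBE : ‖B u - g‖ ≤ E := Real.le_sqrt_of_sq_le (le_add_of_nonneg_right (sq_nonneg _))
  have hp : 0 ≤ ε * ‖γ₀ u‖ := by positivity
  set S := E + ε * ‖γ₀ u‖ with hS
  have hS0 : 0 ≤ S := by positivity
  have hsqrt : Real.sqrt 2 ^ 2 = 2 := Real.sq_sqrt zero_le_two
  have hsqrt1 : 1 ≤ Real.sqrt 2 := Real.one_le_sqrt.mpr one_le_two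
  have hmin_le : ‖B uε - g‖ + ε * ‖γ₀ uε‖ ≤ Real.sqrt 2 * S := by
    refine (sq_le_sq₀ (by positivity) (by positivity)).mp ?_
    rw [mul_pow, hsqrt]
    nlinarith [hmin u, sq_nonneg (‖B uε - g‖ - ε * ‖γ₀ uε‖), sq_nonneg ‖Γ uε - f‖,
      mul_nonneg hE0 hp]
  have hweighted : ε * (‖B (u - uε)‖ + ‖γ₀ (u - uε)‖) ≤ 2 * Real.sqrt 2 * S := by
    have hB : ε * ‖B (u - uε)‖ ≤ ‖B (u - uε)‖ := mul_le_of_le_one_left (norm_nonneg _) hε1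
    have hγ : ε * ‖γ₀ (u - uε)‖ ≤ ε * (‖γ₀ u‖ + ‖γ₀ uε‖) := by gcongr
    have hSle : S ≤ Real.sqrt 2 * S := le_mul_of_one_le_left hS0 hsqrt1
    linarith
  rw [div_mul_eq_mul_div, le_div_iff₀ hε]
  calc ‖u - uε‖ * ε ≤ c₀ * (‖B (u - uε)‖ + ‖γ₀ (u - uε)‖) * ε := by
        gcongr
        exact hstab _
    _ = c₀ * (ε * (‖B (u - uε)‖ + ‖γ₀ (u - uε)‖)) := by ring
    _ ≤ c₀ * (2 * Real.sqrt 2 * S) := by gcongr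
    _ = 2 * Real.sqrt 2 * c₀ * S := by ring
end

section
/- Under the Carleman hypothesis, if ε ≥ 0 and u_ε ∈ X satisfies G_ε(u_ε) ≤ G_ε(w) for all w ∈ X, then for every w ∈ X one has the a posteriori bound N(u_ε − w) ≤ 2C_η·√(G_ε(w)). -/
/-- Relaxed parallelogram bound, valid in any seminormed group. -/
theorem norm_sub_sq_le_two_mul {E : Type*} [SeminormedAddCommGroup E] (a b c : E) :
    ‖a - b‖ ^ 2 ≤ 2 * ‖a - c‖ ^ 2 + 2 * ‖b - c‖ ^ 2 := by
  have h : ‖a - b‖ ≤ ‖a - c‖ + ‖b - c‖ := by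
    simpa using norm_sub_le (a - c) (b - c)
  nlinarith [norm_nonneg (a - b), sq_nonneg (‖a - c‖ - ‖b - c‖)]

/-- Proposition 3.3: a posteriori bound for the deviation from `uε`. -/
theorem stmt_5
    {X Y Hω H₀ : Type*}
    [NormedAddCommGroup X] [InnerProductSpace ℝ X] [CompleteSpace X]
    [NormedAddCommGroup Y] [InnerProductSpace ℝ Y] [CompleteSpace Y]
    [NormedAddCommGroup Hω] [InnerProductSpace ℝ Hω] [CompleteSpace Hω]
    [NormedAddCommGroup H₀] [InnerProductSpace ℝ H₀] [CompleteSpace H₀]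
    (B : X →L[ℝ] (Y →L[ℝ] ℝ)) (Γ : X →L[ℝ] Hω) (γ₀ : X →L[ℝ] H₀)
    (g : Y →L[ℝ] ℝ) (f : Hω)
    (N : Seminorm ℝ X) (Cη : ℝ) (hCη : 0 < Cη)
    (hCarl : ∀ w : X, N w ≤ Cη * Real.sqrt (‖B w‖ ^ 2 + ‖Γ w‖ ^ 2))
    (ε : ℝ) (hε : 0 ≤ ε) (uε : X)
    (hmin : ∀ w : X,
      ‖B uε - g‖ ^ 2 + ‖Γ uε - f‖ ^ 2 + ε ^ 2 * ‖γ₀ uε‖ ^ 2 ≤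
        ‖B w - g‖ ^ 2 + ‖Γ w - f‖ ^ 2 + ε ^ 2 * ‖γ₀ w‖ ^ 2) :
    ∀ w : X,
      N (uε - w) ≤ 2 * Cη *
        Real.sqrt (‖B w - g‖ ^ 2 + ‖Γ w - f‖ ^ 2 + ε ^ 2 * ‖γ₀ w‖ ^ 2) := by
  intro w
  have key : ‖B (uε - w)‖ ^ 2 + ‖Γ (uε - w)‖ ^ 2 ≤
      2 ^ 2 * (‖B w - g‖ ^ 2 + ‖Γ w - f‖ ^ 2 + ε ^ 2 * ‖γ₀ w‖ ^ 2) := by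
    rw [map_sub, map_sub]
    have h₀ : 0 ≤ ε ^ 2 * ‖γ₀ uε‖ ^ 2 := by positivity
    have h₁ : 0 ≤ ε ^ 2 * ‖γ₀ w‖ ^ 2 := by positivity
    linarith [hmin w, norm_sub_sq_le_two_mul (B uε) (B w) g,
      norm_sub_sq_le_two_mul (Γ uε) (Γ w) f]
  calc N (uε - w)
      ≤ Cη * √(‖B (uε - w)‖ ^ 2 + ‖Γ (uε - w)‖ ^ 2) := hCarl _
    _ ≤ Cη * √(2 ^ 2 * (‖B w - g‖ ^ 2 + ‖Γ w - f‖ ^ 2 + ε ^ 2 * ‖γ₀ w‖ ^ 2)) := by gcongr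
    _ = 2 * Cη * √(‖B w - g‖ ^ 2 + ‖Γ w - f‖ ^ 2 + ε ^ 2 * ‖γ₀ w‖ ^ 2) := by
      rw [Real.sqrt_mul (by positivity), Real.sqrt_sq (by positivity)]
      ring
end

section
/- Under the Carleman hypothesis, let X^δ ⊆ X be a subspace, let ε ≥ 0, and let u_ε^δ ∈ X^δ satisfy G_ε(u_ε^δ) ≤ G_ε(v) for all v ∈ X^δ. Then for every u ∈ X and every w ∈ X^δ one has the a priori bound N(u − u_ε^δ) ≤ C_η·(2·e_cons(u) + √(‖B‖² + ‖Γ‖² + ε²‖γ₀‖²)·‖u − w‖_X + ε‖γ₀u‖_{H₀}). -/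
/-- Minkowski's inequality in `ℝ³`, for a vector dominated coordinatewise by a sum. -/
lemma sqrt_sum_sq_le_add {a₁ a₂ a₃ b₁ b₂ b₃ c₁ c₂ c₃ : ℝ}
    (hc₁ : 0 ≤ c₁) (hc₂ : 0 ≤ c₂) (hc₃ : 0 ≤ c₃)
    (h₁ : c₁ ≤ a₁ + b₁) (h₂ : c₂ ≤ a₂ + b₂) (h₃ : c₃ ≤ a₃ + b₃) :
    √(c₁ ^ 2 + c₂ ^ 2 + c₃ ^ 2) ≤
      √(a₁ ^ 2 + a₂ ^ 2 + a₃ ^ 2) + √(b₁ ^ 2 + b₂ ^ 2 + b₃ ^ 2) := by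
  have hcs : a₁ * b₁ + a₂ * b₂ + a₃ * b₃ ≤
      √(a₁ ^ 2 + a₂ ^ 2 + a₃ ^ 2) * √(b₁ ^ 2 + b₂ ^ 2 + b₃ ^ 2) := by
    simpa [Fin.sum_univ_three] using
      Real.sum_mul_le_sqrt_mul_sqrt Finset.univ ![a₁, a₂, a₃] ![b₁, b₂, b₃]
  refine Real.sqrt_le_iff.2 ⟨by positivity, ?_⟩
  rw [add_sq, Real.sq_sqrt (by positivity), Real.sq_sqrt (by positivity)]
  have e₁ := pow_le_pow_left₀ hc₁ h₁ 2
  have e₂ := pow_le_pow_left₀ hc₂ h₂ 2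
  have e₃ := pow_le_pow_left₀ hc₃ h₃ 2
  linarith

/-- Proposition 3.4: a priori bound for the minimizer over a subspace. -/
theorem stmt_6
    {X Y Hω H₀ : Type*}
    [NormedAddCommGroup X] [InnerProductSpace ℝ X] [CompleteSpace X]
    [NormedAddCommGroup Y] [InnerProductSpace ℝ Y] [CompleteSpace Y]
    [NormedAddCommGroup Hω] [InnerProductSpace ℝ Hω] [CompleteSpace Hω]
    [NormedAddCommGroup H₀] [InnerProductSpace ℝ H₀] [CompleteSpace H₀]
    (B : X →L[ℝ] (Y →L[ℝ] ℝ)) (Γ : X →L[ℝ] Hω) (γ₀ : X →L[ℝ] H₀)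
    (g : Y →L[ℝ] ℝ) (f : Hω)
    (N : Seminorm ℝ X) (Cη : ℝ) (hCη : 0 < Cη)
    (hCarl : ∀ w : X, N w ≤ Cη * Real.sqrt (‖B w‖ ^ 2 + ‖Γ w‖ ^ 2))
    (Xδ : Submodule ℝ X) (ε : ℝ) (hε : 0 ≤ ε)
    (uεδ : X) (huεδ : uεδ ∈ Xδ)
    (hmin : ∀ v ∈ Xδ,
      ‖B uεδ - g‖ ^ 2 + ‖Γ uεδ - f‖ ^ 2 + ε ^ 2 * ‖γ₀ uεδ‖ ^ 2 ≤
        ‖B v - g‖ ^ 2 + ‖Γ v - f‖ ^ 2 + ε ^ 2 * ‖γ₀ v‖ ^ 2) :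
    ∀ u : X, ∀ w ∈ Xδ,
      N (u - uεδ) ≤ Cη *
        (2 * Real.sqrt (‖B u - g‖ ^ 2 + ‖Γ u - f‖ ^ 2) +
         Real.sqrt (‖B‖ ^ 2 + ‖Γ‖ ^ 2 + ε ^ 2 * ‖γ₀‖ ^ 2) * ‖u - w‖ +
         ε * ‖γ₀ u‖) := by
  intro u w hw
  have herr : √(‖B (u - uεδ)‖ ^ 2 + ‖Γ (u - uεδ)‖ ^ 2) ≤
      √(‖B u - g‖ ^ 2 + ‖Γ u - f‖ ^ 2) + √(‖B uεδ - g‖ ^ 2 + ‖Γ uεδ - f‖ ^ 2) := by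
    have hB : ‖B (u - uεδ)‖ ≤ ‖B u - g‖ + ‖B uεδ - g‖ := by
      simpa using norm_sub_le (B u - g) (B uεδ - g)
    have hΓ : ‖Γ (u - uεδ)‖ ≤ ‖Γ u - f‖ + ‖Γ uεδ - f‖ := by
      simpa using norm_sub_le (Γ u - f) (Γ uεδ - f)
    simpa using sqrt_sum_sq_le_add (norm_nonneg _) (norm_nonneg _) le_rfl hB hΓ
      (add_zero (0 : ℝ)).ge
  have hquasi : √(‖B uεδ - g‖ ^ 2 + ‖Γ uεδ - f‖ ^ 2) ≤
      √(‖B w - g‖ ^ 2 + ‖Γ w - f‖ ^ 2 + (ε * ‖γ₀ w‖) ^ 2) := by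
    refine Real.sqrt_le_sqrt ?_
    have := hmin w hw
    rw [mul_pow]
    linarith [mul_nonneg (sq_nonneg ε) (sq_nonneg ‖γ₀ uεδ‖)]
  have hperturb : √(‖B w - g‖ ^ 2 + ‖Γ w - f‖ ^ 2 + (ε * ‖γ₀ w‖) ^ 2) ≤
      √(‖B u - g‖ ^ 2 + ‖Γ u - f‖ ^ 2 + (ε * ‖γ₀ u‖) ^ 2) +
        √((‖B‖ * ‖u - w‖) ^ 2 + (‖Γ‖ * ‖u - w‖) ^ 2 + (ε * ‖γ₀‖ * ‖u - w‖) ^ 2) := by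
    refine sqrt_sum_sq_le_add (norm_nonneg _) (norm_nonneg _) (by positivity) ?_ ?_ ?_
    · calc ‖B w - g‖ = ‖(B u - g) - B (u - w)‖ := by rw [map_sub]; congr 1; abel
        _ ≤ ‖B u - g‖ + ‖B‖ * ‖u - w‖ :=
          (norm_sub_le _ _).trans (by gcongr; exact B.le_opNorm _)
    · calc ‖Γ w - f‖ = ‖(Γ u - f) - Γ (u - w)‖ := by rw [map_sub]; congr 1; abel
        _ ≤ ‖Γ u - f‖ + ‖Γ‖ * ‖u - w‖ :=
          (norm_sub_le _ _).trans (by gcongr; exact Γ.le_opNorm _)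
    · calc ε * ‖γ₀ w‖ = ε * ‖γ₀ u - γ₀ (u - w)‖ := by rw [map_sub]; congr 2; abel
        _ ≤ ε * (‖γ₀ u‖ + ‖γ₀‖ * ‖u - w‖) := by
          gcongr
          exact (norm_sub_le _ _).trans (by gcongr; exact γ₀.le_opNorm _)
        _ = ε * ‖γ₀ u‖ + ε * ‖γ₀‖ * ‖u - w‖ := by ring
  have hop : √((‖B‖ * ‖u - w‖) ^ 2 + (‖Γ‖ * ‖u - w‖) ^ 2 + (ε * ‖γ₀‖ * ‖u - w‖) ^ 2) =
      √(‖B‖ ^ 2 + ‖Γ‖ ^ 2 + ε ^ 2 * ‖γ₀‖ ^ 2) * ‖u - w‖ := by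
    simp only [mul_pow, ← add_mul]
    rw [Real.sqrt_mul (by positivity), Real.sqrt_sq (norm_nonneg _)]
  have hsplit : √(‖B u - g‖ ^ 2 + ‖Γ u - f‖ ^ 2 + (ε * ‖γ₀ u‖) ^ 2) ≤
      √(‖B u - g‖ ^ 2 + ‖Γ u - f‖ ^ 2) + ε * ‖γ₀ u‖ := by
    simpa [Real.sqrt_sq (mul_nonneg hε (norm_nonneg (γ₀ u)))] using
      sqrt_sum_sq_le_add (norm_nonneg (B u - g)) (norm_nonneg (Γ u - f))
        (mul_nonneg hε (norm_nonneg (γ₀ u)))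
        (add_zero _).ge (add_zero _).ge (zero_add _).ge
  refine (hCarl _).trans (mul_le_mul_of_nonneg_left ?_ hCη.le)
  linarith
end

section
/- If ε ≥ 0 and u_ε ∈ X satisfies G_ε(u_ε) ≤ G_ε(w) for all w ∈ X, then for every u ∈ X one has e_cons(u_ε) ≤ e_cons(u) + ε‖γ₀u‖_{H₀}; in particular the consistency error of u_ε exceeds the minimal consistency error inf_{u ∈ X} e_cons(u) by at most ε·inf over minimizers of ‖γ₀·‖. -/
/-- The consistency error of the regularized minimizer `uε` exceeds that of any
reference state `u` by at most `ε * ‖γ₀ u‖`. -/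
theorem stmt_7
    {X Y Hω H₀ : Type*}
    [NormedAddCommGroup X] [InnerProductSpace ℝ X] [CompleteSpace X]
    [NormedAddCommGroup Y] [InnerProductSpace ℝ Y] [CompleteSpace Y]
    [NormedAddCommGroup Hω] [InnerProductSpace ℝ Hω] [CompleteSpace Hω]
    [NormedAddCommGroup H₀] [InnerProductSpace ℝ H₀] [CompleteSpace H₀]
    (B : X →L[ℝ] (Y →L[ℝ] ℝ)) (Γ : X →L[ℝ] Hω) (γ₀ : X →L[ℝ] H₀)
    (g : Y →L[ℝ] ℝ) (f : Hω)
    (ε : ℝ) (hε : 0 ≤ ε) (uε : X)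
    (hmin : ∀ w : X,
      ‖B uε - g‖ ^ 2 + ‖Γ uε - f‖ ^ 2 + ε ^ 2 * ‖γ₀ uε‖ ^ 2 ≤
        ‖B w - g‖ ^ 2 + ‖Γ w - f‖ ^ 2 + ε ^ 2 * ‖γ₀ w‖ ^ 2) :
    ∀ u : X,
      Real.sqrt (‖B uε - g‖ ^ 2 + ‖Γ uε - f‖ ^ 2) ≤
        Real.sqrt (‖B u - g‖ ^ 2 + ‖Γ u - f‖ ^ 2) + ε * ‖γ₀ u‖ := by
  intro u
  have hu : 0 ≤ ε * ‖γ₀ u‖ := by positivity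
  have hsqrt := Real.sqrt_nonneg (‖B u - g‖ ^ 2 + ‖Γ u - f‖ ^ 2)
  refine Real.sqrt_le_iff.mpr ⟨by positivity, ?_⟩
  calc ‖B uε - g‖ ^ 2 + ‖Γ uε - f‖ ^ 2
      ≤ ‖B uε - g‖ ^ 2 + ‖Γ uε - f‖ ^ 2 + ε ^ 2 * ‖γ₀ uε‖ ^ 2 :=
        le_add_of_nonneg_right (by positivity)
    _ ≤ ‖B u - g‖ ^ 2 + ‖Γ u - f‖ ^ 2 + ε ^ 2 * ‖γ₀ u‖ ^ 2 := hmin u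
    _ = Real.sqrt (‖B u - g‖ ^ 2 + ‖Γ u - f‖ ^ 2) ^ 2 + (ε * ‖γ₀ u‖) ^ 2 := by
        rw [Real.sq_sqrt (by positivity), mul_pow]
    _ ≤ (Real.sqrt (‖B u - g‖ ^ 2 + ‖Γ u - f‖ ^ 2) + ε * ‖γ₀ u‖) ^ 2 := by
        nlinarith [mul_nonneg hsqrt hu]
end

section
/- Under the Carleman hypothesis, fix γ > 0. There exists a constant C' > 0, depending only on C_η, γ, ‖B‖, ‖Γ‖ and ‖γ₀‖, such that the following holds: for all finite-dimensional subspaces X^δ ⊆ X and Y^δ ⊆ Y satisfying the inf-sup condition γ·‖Bw‖_{Y'} ≤ ‖Bw‖_{(Y^δ)'} for all w ∈ X^δ, for all 0 ≤ ε ≤ 1, for all data g ∈ Y' and f ∈ H_ω, for every u_ε^{δ,δ} ∈ X^δ with G_ε^δ(u_ε^{δ,δ}) ≤ G_ε^δ(v) for all v ∈ X^δ, and for every u ∈ X and w ∈ X^δ: N(u − u_ε^{δ,δ}) ≤ C'·(e_cons(u) + ‖u − w‖_X + ε‖γ₀u‖_{H₀}). -/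
/-- The discrete dual norm `‖ℓ‖_{(Y^δ)'} = sup { ℓ μ : μ ∈ Y^δ, ‖μ‖ ≤ 1 }`. -/
noncomputable def discreteDualNorm {Y : Type*} [NormedAddCommGroup Y]
    [InnerProductSpace ℝ Y] (Yδ : Submodule ℝ Y) (ℓ : Y →L[ℝ] ℝ) : ℝ :=
  sSup ((fun μ => ℓ μ) '' {μ : Y | μ ∈ Yδ ∧ ‖μ‖ ≤ 1})

section DiscreteDualNorm

variable {Y : Type*} [NormedAddCommGroup Y] [InnerProductSpace ℝ Y] (Yδ : Submodule ℝ Y)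

theorem le_discreteDualNorm (ℓ : Y →L[ℝ] ℝ) {μ : Y} (hμ : μ ∈ Yδ) (hμ1 : ‖μ‖ ≤ 1) :
    ℓ μ ≤ discreteDualNorm Yδ ℓ := by
  refine le_csSup ⟨‖ℓ‖, ?_⟩ ⟨μ, ⟨hμ, hμ1⟩, rfl⟩
  rintro _ ⟨ν, ⟨-, hν⟩, rfl⟩
  exact (le_abs_self _).trans (ℓ.unit_le_opNorm ν hν)

theorem discreteDualNorm_le {ℓ : Y →L[ℝ] ℝ} {a : ℝ}
    (h : ∀ μ ∈ Yδ, ‖μ‖ ≤ 1 → ℓ μ ≤ a) : discreteDualNorm Yδ ℓ ≤ a := by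
  refine csSup_le ⟨ℓ 0, 0, ⟨Yδ.zero_mem, by simp⟩, rfl⟩ ?_
  rintro _ ⟨μ, ⟨hμ, hμ1⟩, rfl⟩
  exact h μ hμ hμ1

theorem discreteDualNorm_nonneg (ℓ : Y →L[ℝ] ℝ) : 0 ≤ discreteDualNorm Yδ ℓ := by
  simpa using le_discreteDualNorm Yδ ℓ Yδ.zero_mem (by simp)

theorem discreteDualNorm_le_norm (ℓ : Y →L[ℝ] ℝ) : discreteDualNorm Yδ ℓ ≤ ‖ℓ‖ :=
  discreteDualNorm_le Yδ fun μ _ hμ1 => (le_abs_self _).trans (ℓ.unit_le_opNorm μ hμ1)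

theorem discreteDualNorm_sub_le (ℓ m : Y →L[ℝ] ℝ) :
    discreteDualNorm Yδ (ℓ - m) ≤ discreteDualNorm Yδ ℓ + discreteDualNorm Yδ m := by
  refine discreteDualNorm_le Yδ fun μ hμ hμ1 => ?_
  have h1 := le_discreteDualNorm Yδ ℓ hμ hμ1
  have h2 := le_discreteDualNorm Yδ m (Yδ.neg_mem hμ) (by rwa [norm_neg])
  rw [map_neg] at h2
  rw [sub_apply]
  linarith

end DiscreteDualNorm

/-- Perturbing the argument of a residual `A u - g` costs at most `‖A‖ * ‖u - w‖`. -/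
theorem norm_map_sub_le_add_opNorm_mul {E F : Type*} [SeminormedAddCommGroup E] [NormedSpace ℝ E]
    [SeminormedAddCommGroup F] [NormedSpace ℝ F] (A : E →L[ℝ] F) (g : F) (u w : E) :
    ‖A w - g‖ ≤ ‖A u - g‖ + ‖A‖ * ‖u - w‖ := by
  calc ‖A w - g‖ = ‖(A u - g) - A (u - w)‖ := by rw [map_sub]; congr 1; abel
    _ ≤ ‖A u - g‖ + ‖A (u - w)‖ := norm_sub_le _ _
    _ ≤ _ := by gcongr; exact A.le_opNorm _

theorem sq_add_sq_add_sq_le_add_sq {a b c : ℝ} (ha : 0 ≤ a) (hb : 0 ≤ b) (hc : 0 ≤ c) :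
    a ^ 2 + b ^ 2 + c ^ 2 ≤ (a + b + c) ^ 2 := by
  linarith [mul_nonneg ha hb, mul_nonneg ha hc, mul_nonneg hb hc]

theorem Real.sqrt_sq_add_sq_le_add {a b : ℝ} (ha : 0 ≤ a) (hb : 0 ≤ b) :
    Real.sqrt (a ^ 2 + b ^ 2) ≤ a + b :=
  Real.sqrt_le_iff.2 ⟨by positivity, by linarith [mul_nonneg ha hb]⟩

/-- Theorem 3.7: robust a priori bound for the fully discrete minimizer under
the uniform inf-sup condition. -/
theorem stmt_8
    {X Y Hω H₀ : Type*}
    [NormedAddCommGroup X] [InnerProductSpace ℝ X] [CompleteSpace X]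
    [NormedAddCommGroup Y] [InnerProductSpace ℝ Y] [CompleteSpace Y]
    [NormedAddCommGroup Hω] [InnerProductSpace ℝ Hω] [CompleteSpace Hω]
    [NormedAddCommGroup H₀] [InnerProductSpace ℝ H₀] [CompleteSpace H₀]
    (B : X →L[ℝ] (Y →L[ℝ] ℝ)) (Γ : X →L[ℝ] Hω) (γ₀ : X →L[ℝ] H₀)
    (N : Seminorm ℝ X) (Cη : ℝ) (hCη : 0 < Cη)
    (hCarl : ∀ w : X, N w ≤ Cη * Real.sqrt (‖B w‖ ^ 2 + ‖Γ w‖ ^ 2))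
    (γ : ℝ) (hγ : 0 < γ) :
    ∃ C' > (0 : ℝ),
      ∀ (Xδ : Submodule ℝ X) (Yδ : Submodule ℝ Y),
        FiniteDimensional ℝ Xδ → FiniteDimensional ℝ Yδ →
        (∀ w ∈ Xδ, γ * ‖B w‖ ≤ discreteDualNorm Yδ (B w)) →
        ∀ ε : ℝ, 0 ≤ ε → ε ≤ 1 →
        ∀ (g : Y →L[ℝ] ℝ) (f : Hω),
        ∀ uδ ∈ Xδ,
          (∀ v ∈ Xδ,
            discreteDualNorm Yδ (B uδ - g) ^ 2 + ‖Γ uδ - f‖ ^ 2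
              + ε ^ 2 * ‖γ₀ uδ‖ ^ 2 ≤
            discreteDualNorm Yδ (B v - g) ^ 2 + ‖Γ v - f‖ ^ 2
              + ε ^ 2 * ‖γ₀ v‖ ^ 2) →
          ∀ u : X, ∀ w ∈ Xδ,
            N (u - uδ) ≤ C' *
              (Real.sqrt (‖B u - g‖ ^ 2 + ‖Γ u - f‖ ^ 2) + ‖u - w‖ +
                ε * ‖γ₀ u‖) := by
  set K : ℝ := 2 + ‖B‖ + ‖Γ‖ + ‖γ₀‖ with hK
  have hb := norm_nonneg B
  have hc := norm_nonneg Γ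
  have hk := norm_nonneg γ₀
  refine ⟨Cη * (K * (3 + 2 * γ⁻¹)), by positivity, ?_⟩
  intro Xδ Yδ _ _ hinf ε hε hε1 g f uδ huδ hmin u w hw
  set E := Real.sqrt (‖B u - g‖ ^ 2 + ‖Γ u - f‖ ^ 2)
  set d := ‖u - w‖
  set s := ε * ‖γ₀ u‖
  have hE : 0 ≤ E := Real.sqrt_nonneg _
  have hd0 : 0 ≤ d := norm_nonneg _
  have hs0 : 0 ≤ s := by positivity
  have hBu : ‖B u - g‖ ≤ E := Real.le_sqrt_of_sq_le (le_add_of_nonneg_right (sq_nonneg _))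
  have hΓu : ‖Γ u - f‖ ≤ E := Real.le_sqrt_of_sq_le (le_add_of_nonneg_left (sq_nonneg _))
  have hBw : discreteDualNorm Yδ (B w - g) ≤ E + ‖B‖ * d :=
    (discreteDualNorm_le_norm Yδ _).trans
      ((norm_map_sub_le_add_opNorm_mul B g u w).trans (by gcongr))
  have hΓw : ‖Γ w - f‖ ≤ E + ‖Γ‖ * d :=
    (norm_map_sub_le_add_opNorm_mul Γ f u w).trans (by gcongr)
  have hγw : ε * ‖γ₀ w‖ ≤ s + ‖γ₀‖ * d := by
    have h := norm_map_sub_le_add_opNorm_mul γ₀ 0 u w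
    rw [sub_zero, sub_zero] at h
    have h' := mul_le_mul_of_nonneg_left h hε
    have : ε * (‖γ₀‖ * d) ≤ ‖γ₀‖ * d := mul_le_of_le_one_left (by positivity) hε1
    rw [mul_add] at h'
    linarith
  set T := E + d + s with hT
  have hbd := mul_nonneg hb hd0
  have hcd := mul_nonneg hc hd0
  have hkd := mul_nonneg hk hd0
  have hKT : 2 * E + (‖B‖ + ‖Γ‖ + ‖γ₀‖) * d + s ≤ K * T := by
    have : 0 ≤ (‖B‖ + ‖Γ‖ + ‖γ₀‖) * (E + s) := by positivity
    rw [hK, hT]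
    linarith
  have hT0 : 0 ≤ K * T := by positivity
  have hDw := discreteDualNorm_nonneg Yδ (B w - g)
  have hΓw0 := norm_nonneg (Γ w - f)
  have hγw0 : 0 ≤ ε * ‖γ₀ w‖ := by positivity
  have hfun : discreteDualNorm Yδ (B uδ - g) ^ 2 + ‖Γ uδ - f‖ ^ 2 ≤ (K * T) ^ 2 := by
    calc _ ≤ discreteDualNorm Yδ (B uδ - g) ^ 2 + ‖Γ uδ - f‖ ^ 2 + ε ^ 2 * ‖γ₀ uδ‖ ^ 2 :=
          le_add_of_nonneg_right (by positivity)
      _ ≤ discreteDualNorm Yδ (B w - g) ^ 2 + ‖Γ w - f‖ ^ 2 + ε ^ 2 * ‖γ₀ w‖ ^ 2 := hmin w hw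
      _ ≤ (discreteDualNorm Yδ (B w - g) + ‖Γ w - f‖ + ε * ‖γ₀ w‖) ^ 2 := by
          rw [← mul_pow]
          exact sq_add_sq_add_sq_le_add_sq hDw hΓw0 hγw0
      _ ≤ (K * T) ^ 2 := by
          gcongr
          linarith
  have hBδ : discreteDualNorm Yδ (B uδ - g) ≤ K * T :=
    (le_abs_self _).trans (abs_le_of_sq_le_sq
      ((le_add_of_nonneg_right (sq_nonneg _)).trans hfun) hT0)
  have hΓδ : ‖Γ uδ - f‖ ≤ K * T :=
    (le_abs_self _).trans (abs_le_of_sq_le_sq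
      ((le_add_of_nonneg_left (sq_nonneg _)).trans hfun) hT0)
  have hBdiscrete : ‖B (w - uδ)‖ ≤ γ⁻¹ * (2 * (K * T)) := by
    rw [le_inv_mul_iff₀ hγ]
    have h := discreteDualNorm_sub_le Yδ (B w - g) (B uδ - g)
    rw [sub_sub_sub_cancel_right, ← map_sub] at h
    linarith [hinf (w - uδ) (Xδ.sub_mem hw huδ)]
  have hB : ‖B (u - uδ)‖ ≤ ‖B‖ * d + γ⁻¹ * (2 * (K * T)) := by
    rw [← sub_add_sub_cancel u w uδ, map_add]
    exact (norm_add_le _ _).trans (add_le_add (B.le_opNorm _) hBdiscrete)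
  have hΓ : ‖Γ (u - uδ)‖ ≤ E + K * T := by
    have h := norm_sub_le (Γ u - f) (Γ uδ - f)
    rw [sub_sub_sub_cancel_right, ← map_sub] at h
    linarith
  calc N (u - uδ) ≤ Cη * Real.sqrt (‖B (u - uδ)‖ ^ 2 + ‖Γ (u - uδ)‖ ^ 2) := hCarl _
    _ ≤ Cη * (‖B (u - uδ)‖ + ‖Γ (u - uδ)‖) := by
        gcongr
        exact Real.sqrt_sq_add_sq_le_add (norm_nonneg _) (norm_nonneg _)
    _ ≤ Cη * (K * T * (3 + 2 * γ⁻¹)) := by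
        gcongr
        linarith
    _ = Cη * (K * (3 + 2 * γ⁻¹)) * T := by ring
end

section
/- Let X^δ ⊆ X and Y^δ ⊆ Y be finite-dimensional subspaces, and suppose γ > 0 satisfies γ·‖Bw‖_{Y'} ≤ ‖Bw‖_{(Y^δ)'} for all w ∈ X^δ (inf-sup condition). Then there exists a bounded linear projector Q : Y → Y (i.e., Q ∘ Q = Q) whose range is contained in Y^δ, such that (Bw)(μ − Qμ) = 0 for all w ∈ X^δ and all μ ∈ Y, and such that ‖Q‖ ≤ 2 + 1/γ. -/
/-- The discrete dual norm of a functional is at most the norm of the projection onto `Yδ` of its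
Riesz representative. -/
lemma discreteDualNorm_le_norm_starProjection {Y : Type*} [NormedAddCommGroup Y]
    [InnerProductSpace ℝ Y] (Yδ : Submodule ℝ Y) [Yδ.HasOrthogonalProjection]
    (ℓ : Y →L[ℝ] ℝ) (v : Y) (h : ∀ y, inner ℝ v y = ℓ y) :
    discreteDualNorm Yδ ℓ ≤ ‖Yδ.starProjection v‖ := by
  refine csSup_le ⟨ℓ 0, 0, by simp, rfl⟩ ?_
  rintro _ ⟨μ, ⟨hμ, hμ1⟩, rfl⟩
  have e : ℓ μ = inner ℝ (Yδ.starProjection v) μ := by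
    rw [Submodule.inner_starProjection_left_eq_right,
      Submodule.starProjection_eq_self_iff.2 hμ, h]
  calc ℓ μ = inner ℝ (Yδ.starProjection v) μ := e
    _ ≤ ‖Yδ.starProjection v‖ * ‖μ‖ := real_inner_le_norm _ _
    _ ≤ ‖Yδ.starProjection v‖ := mul_le_of_le_one_right (norm_nonneg _) hμ1

/-- If the orthogonal projection onto `K` is bounded below by `γ` on `V`, there is an oblique
projection onto `V` that factors through the projection onto `K` and has norm at most `1 / γ`. -/
lemma exists_oblique_projection {Y : Type*} [NormedAddCommGroup Y] [InnerProductSpace ℝ Y]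
    (V K : Submodule ℝ Y) [FiniteDimensional ℝ K] {γ : ℝ} (hγ : 0 < γ)
    (h : ∀ v ∈ V, γ * ‖v‖ ≤ ‖K.starProjection v‖) :
    ∃ T : Y →L[ℝ] Y, (∀ y, T y ∈ V) ∧ (∀ v ∈ V, T v = v) ∧
      (∀ y, T (K.starProjection y) = T y) ∧ ‖T‖ ≤ 1 / γ := by
  let f : V →ₗ[ℝ] Y := (K.starProjection : Y →ₗ[ℝ] Y) ∘ₗ V.subtype
  have hf : Function.Injective f := by
    rw [injective_iff_map_eq_zero]
    intro v hv
    have h1 : γ * ‖(v : Y)‖ ≤ ‖f v‖ := h v v.2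
    rw [hv, norm_zero] at h1
    have h2 : ‖(v : Y)‖ ≤ 0 := nonpos_of_mul_nonpos_right h1 hγ
    exact Subtype.ext (norm_le_zero_iff.1 h2)
  have hle : LinearMap.range f ≤ K := by
    rintro _ ⟨v, rfl⟩
    exact K.starProjection_apply_mem v
  have : FiniteDimensional ℝ (LinearMap.range f) := Submodule.finiteDimensional_of_le hle
  let e := LinearEquiv.ofInjective f hf
  let T₀ : Y →ₗ[ℝ] Y := V.subtype ∘ₗ (e.symm : LinearMap.range f →ₗ[ℝ] V) ∘ₗ
    ((LinearMap.range f).orthogonalProjectionOnto : Y →ₗ[ℝ] LinearMap.range f)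
  have bound : ∀ y, ‖T₀ y‖ ≤ 1 / γ * ‖y‖ := by
    intro y
    set u := (LinearMap.range f).orthogonalProjectionOnto y with hu
    have h1 : γ * ‖(e.symm u : Y)‖ ≤ ‖f (e.symm u)‖ := h _ (e.symm u).2
    have h2 : f (e.symm u) = u := congrArg Subtype.val (e.apply_symm_apply u)
    have h3 : ‖(u : Y)‖ ≤ ‖y‖ := (LinearMap.range f).norm_orthogonalProjectionOnto_apply_le y
    rw [h2] at h1
    change ‖(e.symm u : Y)‖ ≤ _
    rw [one_div, inv_mul_eq_div, le_div_iff₀ hγ]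
    linarith
  have hP : ∀ y, T₀ (K.starProjection y) = T₀ y := by
    intro y
    change ((e.symm ((LinearMap.range f).orthogonalProjectionOnto (K.starProjection y)) : V)
      : Y) = e.symm ((LinearMap.range f).orthogonalProjectionOnto y)
    rw [Submodule.orthogonalProjectionOnto_starProjection_of_le hle]
  refine ⟨T₀.mkContinuous (1 / γ) bound, fun y => (e.symm _).2, fun v hv => ?_, hP,
    T₀.mkContinuous_norm_le (by positivity) bound⟩
  have h1 : (LinearMap.range f).orthogonalProjectionOnto (K.starProjection v) = e ⟨v, hv⟩ :=
    Submodule.orthogonalProjectionOnto_mem_subspace_eq_self (e ⟨v, hv⟩)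
  change T₀ v = v
  rw [← hP v]
  change ((e.symm ((LinearMap.range f).orthogonalProjectionOnto (K.starProjection v)) : V) : Y) = v
  rw [h1, e.symm_apply_apply]

/-- The inf-sup condition implies the existence of a Fortin projector with
norm at most `2 + 1/γ`. -/
theorem stmt_10
    {X Y : Type*}
    [NormedAddCommGroup X] [InnerProductSpace ℝ X] [CompleteSpace X]
    [NormedAddCommGroup Y] [InnerProductSpace ℝ Y] [CompleteSpace Y]
    (B : X →L[ℝ] (Y →L[ℝ] ℝ))
    (Xδ : Submodule ℝ X) (Yδ : Submodule ℝ Y)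
    [FiniteDimensional ℝ Xδ] [FiniteDimensional ℝ Yδ]
    (γ : ℝ) (hγ : 0 < γ)
    (hinfsup : ∀ w ∈ Xδ, γ * ‖B w‖ ≤ discreteDualNorm Yδ (B w)) :
    ∃ Q : Y →L[ℝ] Y,
      Q.comp Q = Q ∧
      (∀ μ : Y, Q μ ∈ Yδ) ∧
      (∀ w ∈ Xδ, ∀ μ : Y, B w (μ - Q μ) = 0) ∧
      ‖Q‖ ≤ 2 + 1 / γ := by
  let V : Submodule ℝ Y :=
    { carrier := {v | ∃ w ∈ Xδ, ∀ y, inner ℝ v y = B w y}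
      zero_mem' := ⟨0, Xδ.zero_mem, by simp⟩
      add_mem' := by
        rintro a b ⟨w, hw, h⟩ ⟨w', hw', h'⟩
        exact ⟨w + w', Xδ.add_mem hw hw', by simp [inner_add_left, h, h']⟩
      smul_mem' := by
        rintro c a ⟨w, hw, h⟩
        exact ⟨c • w, Xδ.smul_mem c hw, by simp [real_inner_smul_left, h]⟩ }
  have hV : ∀ v ∈ V, γ * ‖v‖ ≤ ‖Yδ.starProjection v‖ := by
    rintro v ⟨w, hw, h⟩
    have hnorm : ‖v‖ = ‖B w‖ := by
      rw [← (InnerProductSpace.toDual ℝ Y).norm_map v]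
      exact congrArg _ (ContinuousLinearMap.ext h)
    rw [hnorm]
    exact (hinfsup w hw).trans (discreteDualNorm_le_norm_starProjection Yδ (B w) v h)
  obtain ⟨T, hTV, hTid, hTP, hT⟩ := exists_oblique_projection V Yδ hγ hV
  refine ⟨T.adjoint, ?_, fun μ => ?_, fun w hw μ => ?_, ?_⟩
  · rw [← ContinuousLinearMap.adjoint_comp]
    congr 1
    ext y
    exact hTid _ (hTV y)
  · rw [← Submodule.starProjection_eq_self_iff]
    refine ext_inner_right ℝ fun y => ?_
    rw [Submodule.inner_starProjection_left_eq_right, ContinuousLinearMap.adjoint_inner_left,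
      ContinuousLinearMap.adjoint_inner_left, hTP]
  · have h : ∀ y, inner ℝ ((InnerProductSpace.toDual ℝ Y).symm (B w)) y = B w y :=
      fun y => InnerProductSpace.toDual_symm_apply
    rw [← h, inner_sub_right, ContinuousLinearMap.adjoint_inner_right, hTid _ ⟨w, hw, h⟩,
      sub_self]
  · rw [LinearIsometryEquiv.norm_map]
    linarith
end

section
/- In the FOSLS setting under the Carleman hypothesis, for every u, w ∈ X and every q ∈ Z one has N(u − w) ≤ C_η·(√2·√(H_0(w,q)) + e_cons(u)). -/
/-- The triangle inequality for the Euclidean norm of pairs of real numbers. -/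
theorem Real.sqrt_add_sq_add_add_sq_le (a b c d : ℝ) :
    √((a + b) ^ 2 + (c + d) ^ 2) ≤ √(a ^ 2 + c ^ 2) + √(b ^ 2 + d ^ 2) := by
  have hac : 0 ≤ a ^ 2 + c ^ 2 := by positivity
  have hbd : 0 ≤ b ^ 2 + d ^ 2 := by positivity
  have cauchy : a * b + c * d ≤ √(a ^ 2 + c ^ 2) * √(b ^ 2 + d ^ 2) := by
    rw [← Real.sqrt_mul hac]
    exact Real.le_sqrt_of_sq_le (by nlinarith [sq_nonneg (a * d - b * c)])
  refine Real.sqrt_le_iff.2 ⟨by positivity, ?_⟩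
  nlinarith [Real.sq_sqrt hac, Real.sq_sqrt hbd]

/-- Proposition 4.3 (first part): FOSLS distance bound under the Carleman hypothesis. -/
theorem stmt_15
    {X Y Hω H₀ Z : Type*}
    [NormedAddCommGroup X] [InnerProductSpace ℝ X] [CompleteSpace X]
    [NormedAddCommGroup Y] [InnerProductSpace ℝ Y] [CompleteSpace Y]
    [NormedAddCommGroup Hω] [InnerProductSpace ℝ Hω] [CompleteSpace Hω]
    [NormedAddCommGroup H₀] [InnerProductSpace ℝ H₀] [CompleteSpace H₀]
    [NormedAddCommGroup Z] [InnerProductSpace ℝ Z] [CompleteSpace Z]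
    (B : X →L[ℝ] (Y →L[ℝ] ℝ)) (Γ : X →L[ℝ] Hω) (γ₀ : X →L[ℝ] H₀)
    (g : Y →L[ℝ] ℝ) (f : Hω)
    (gradK : X →L[ℝ] Z) (D : Z →L[ℝ] (Y →L[ℝ] ℝ)) (hD : ‖D‖ ≤ 1)
    (N : Seminorm ℝ X) (Cη : ℝ) (hCη : 0 < Cη)
    (hCarl : ∀ w : X, N w ≤ Cη * Real.sqrt (‖B w‖ ^ 2 + ‖Γ w‖ ^ 2)) :
    ∀ (u w : X) (q : Z),
      N (u - w) ≤ Cη *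
        (Real.sqrt 2 *
          Real.sqrt (‖(B w + D (q - gradK w)) - g‖ ^ 2 + ‖q - gradK w‖ ^ 2 +
            ‖Γ w - f‖ ^ 2) +
         Real.sqrt (‖B u - g‖ ^ 2 + ‖Γ u - f‖ ^ 2)) := by
  intro u w q
  have hBw : ‖B w - g‖ ≤ ‖(B w + D (q - gradK w)) - g‖ + ‖q - gradK w‖ := by
    have hDq : ‖D (q - gradK w)‖ ≤ ‖q - gradK w‖ := by
      simpa using D.le_of_opNorm_le hD (q - gradK w)
    calc ‖B w - g‖ = ‖((B w + D (q - gradK w)) - g) - D (q - gradK w)‖ := by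
          congr 1; abel
      _ ≤ ‖(B w + D (q - gradK w)) - g‖ + ‖D (q - gradK w)‖ := norm_sub_le _ _
      _ ≤ _ := by gcongr
  have hB : ‖B (u - w)‖ ≤ ‖B w - g‖ + ‖B u - g‖ := by
    rw [map_sub, ← sub_sub_sub_cancel_right (B u) (B w) g, add_comm]
    exact norm_sub_le _ _
  have hΓ : ‖Γ (u - w)‖ ≤ ‖Γ w - f‖ + ‖Γ u - f‖ := by
    rw [map_sub, ← sub_sub_sub_cancel_right (Γ u) (Γ w) f, add_comm]
    exact norm_sub_le _ _
  refine (hCarl (u - w)).trans (mul_le_mul_of_nonneg_left ?_ hCη.le)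
  calc √(‖B (u - w)‖ ^ 2 + ‖Γ (u - w)‖ ^ 2)
      ≤ √((‖B w - g‖ + ‖B u - g‖) ^ 2 + (‖Γ w - f‖ + ‖Γ u - f‖) ^ 2) := by gcongr
    _ ≤ √(‖B w - g‖ ^ 2 + ‖Γ w - f‖ ^ 2) + √(‖B u - g‖ ^ 2 + ‖Γ u - f‖ ^ 2) :=
        Real.sqrt_add_sq_add_add_sq_le _ _ _ _
    _ ≤ _ := by
        rw [← Real.sqrt_mul zero_le_two]
        gcongr
        have hsq := pow_le_pow_left₀ (norm_nonneg _) hBw 2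
        nlinarith [sq_nonneg (‖(B w + D (q - gradK w)) - g‖ - ‖q - gradK w‖),
          sq_nonneg ‖Γ w - f‖]
end

section
/- In the FOSLS setting under the Carleman hypothesis, if ε ≥ 0 and (ū_ε, p_ε) ∈ X × Z satisfies H_ε(ū_ε, p_ε) ≤ H_ε(w,q) for all (w,q) ∈ X × Z, then for every (w,q) ∈ X × Z one has the a posteriori bound N(ū_ε − w) ≤ 2√2·C_η·√(H_ε(w,q)). -/
/-- Proposition 4.3 (second part): FOSLS a posteriori bound. -/
theorem stmt_16
    {X Y Hω H₀ Z : Type*}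
    [NormedAddCommGroup X] [InnerProductSpace ℝ X] [CompleteSpace X]
    [NormedAddCommGroup Y] [InnerProductSpace ℝ Y] [CompleteSpace Y]
    [NormedAddCommGroup Hω] [InnerProductSpace ℝ Hω] [CompleteSpace Hω]
    [NormedAddCommGroup H₀] [InnerProductSpace ℝ H₀] [CompleteSpace H₀]
    [NormedAddCommGroup Z] [InnerProductSpace ℝ Z] [CompleteSpace Z]
    (B : X →L[ℝ] (Y →L[ℝ] ℝ)) (Γ : X →L[ℝ] Hω) (γ₀ : X →L[ℝ] H₀)
    (g : Y →L[ℝ] ℝ) (f : Hω)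
    (gradK : X →L[ℝ] Z) (D : Z →L[ℝ] (Y →L[ℝ] ℝ)) (hD : ‖D‖ ≤ 1)
    (N : Seminorm ℝ X) (Cη : ℝ) (hCη : 0 < Cη)
    (hCarl : ∀ w : X, N w ≤ Cη * Real.sqrt (‖B w‖ ^ 2 + ‖Γ w‖ ^ 2))
    (ε : ℝ) (hε : 0 ≤ ε) (uε : X) (pε : Z)
    (hmin : ∀ (w : X) (q : Z),
      ‖(B uε + D (pε - gradK uε)) - g‖ ^ 2 + ‖pε - gradK uε‖ ^ 2 +
          ‖Γ uε - f‖ ^ 2 + ε ^ 2 * ‖γ₀ uε‖ ^ 2 ≤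
        ‖(B w + D (q - gradK w)) - g‖ ^ 2 + ‖q - gradK w‖ ^ 2 +
          ‖Γ w - f‖ ^ 2 + ε ^ 2 * ‖γ₀ w‖ ^ 2) :
    ∀ (w : X) (q : Z),
      N (uε - w) ≤ 2 * Real.sqrt 2 * Cη *
        Real.sqrt (‖(B w + D (q - gradK w)) - g‖ ^ 2 + ‖q - gradK w‖ ^ 2 +
          ‖Γ w - f‖ ^ 2 + ε ^ 2 * ‖γ₀ w‖ ^ 2) := by
  intro w q
  have hm := hmin w q
  set r₁ := (B uε + D (pε - gradK uε)) - g with hr₁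
  set r₂ := (B w + D (q - gradK w)) - g with hr₂
  set s₁ := pε - gradK uε with hs₁
  set s₂ := q - gradK w with hs₂
  have hBeq : B (uε - w) = (r₁ - r₂) - (D s₁ - D s₂) := by
    rw [hr₁, hr₂, map_sub]
    abel
  have hΓeq : Γ (uε - w) = (Γ uε - f) - (Γ w - f) := by
    rw [map_sub]
    abel
  have hDle (z : Z) : ‖D z‖ ≤ ‖z‖ := by
    simpa using D.le_of_opNorm_le hD z
  have hB : ‖B (uε - w)‖ ≤ ‖r₁‖ + ‖r₂‖ + (‖s₁‖ + ‖s₂‖) := by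
    rw [hBeq]
    linarith [norm_sub_le (r₁ - r₂) (D s₁ - D s₂), norm_sub_le r₁ r₂,
      norm_sub_le (D s₁) (D s₂), hDle s₁, hDle s₂]
  have hΓ : ‖Γ (uε - w)‖ ≤ ‖Γ uε - f‖ + ‖Γ w - f‖ := by
    rw [hΓeq]
    exact norm_sub_le _ _
  have hB2 : ‖B (uε - w)‖ ^ 2 ≤ 4 * (‖r₁‖ ^ 2 + ‖r₂‖ ^ 2 + (‖s₁‖ ^ 2 + ‖s₂‖ ^ 2)) := by
    have h := pow_le_pow_left₀ (norm_nonneg _) hB 2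
    linarith [add_sq_le (a := ‖r₁‖ + ‖r₂‖) (b := ‖s₁‖ + ‖s₂‖),
      add_sq_le (a := ‖r₁‖) (b := ‖r₂‖), add_sq_le (a := ‖s₁‖) (b := ‖s₂‖)]
  have hΓ2 : ‖Γ (uε - w)‖ ^ 2 ≤ 2 * (‖Γ uε - f‖ ^ 2 + ‖Γ w - f‖ ^ 2) :=
    (pow_le_pow_left₀ (norm_nonneg _) hΓ 2).trans add_sq_le
  have hsqrt : 2 * Real.sqrt 2 = Real.sqrt 8 := by
    rw [show (8 : ℝ) = 2 ^ 2 * 2 by norm_num, Real.sqrt_mul (by positivity),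
      Real.sqrt_sq (by norm_num)]
  refine (hCarl (uε - w)).trans ?_
  rw [hsqrt, mul_comm (Real.sqrt 8) Cη, mul_assoc, ← Real.sqrt_mul (by norm_num)]
  refine mul_le_mul_of_nonneg_left (Real.sqrt_le_sqrt ?_) hCη.le
  have h₁ : 0 ≤ ε ^ 2 * ‖γ₀ uε‖ ^ 2 := by positivity
  have h₂ : 0 ≤ ε ^ 2 * ‖γ₀ w‖ ^ 2 := by positivity
  linarith [sq_nonneg ‖Γ uε - f‖, sq_nonneg ‖Γ w - f‖]
end
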